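/- Let A be a finite-dimensional associative algebra over a field k (trivially graded, zero differential) that is proper and smooth (A is perfect as a DG A-bimodule, i.e. A admits a finite resolution by finitely generated projective A-bimodules). Then the Hochschild homology of A vanishes in nonzero degrees: HH_n(A) = 0 for n ≠ 0, and HH₀(A) = A/[A,A]. -/

import Mathlib

open CategoryTheory
open scoped TensorProduct

universe u

noncomputable section

/-- The `i`-th face-merging of a Hochschild chain: `a₀ ⊗ … ⊗ aᵢaᵢ₊₁ ⊗ … ⊗ a_{n+1}`. -/
def hmerge {A : Type*} [Mul A] {n : ℕ} (i : Fin (n + 1)) (a : Fin (n + 2) → A) :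
    Fin (n + 1) → A := fun j =>
  if (j : ℕ) < (i : ℕ) then a j.castSucc
  else if (j : ℕ) = (i : ℕ) then a j.castSucc * a j.succ
  else a j.succ

/-- The last face of a Hochschild chain: `a_{n+1}a₀ ⊗ a₁ ⊗ … ⊗ a_n`. -/
def hrot {A : Type*} [Mul A] {n : ℕ} (a : Fin (n + 2) → A) : Fin (n + 1) → A := fun j =>
  if (j : ℕ) = 0 then a (Fin.last (n + 1)) * a 0 else a j.castSucc

section trace

set_option linter.unusedSectionVars false

variable {k : Type u} {A : Type u} [Field k] [Ring A] [Algebra k A]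
variable {ι : Type} [Fintype ι] [DecidableEq ι]

/-- generalized trace -/
def gtr (k : Type u) (A : Type u) [Field k] [Ring A] [Algebra k A] (ι : Type) [Fintype ι]
    [DecidableEq ι] (n : ℕ) :
    MultilinearMap k (fun _ : Fin (n + 1) => Matrix ι ι A) (⨂[k] _ : Fin (n + 1), A) :=
  ∑ i : Fin (n + 1) → ι,
    (PiTensorProduct.tprod k (s := fun _ : Fin (n + 1) => A)).compLinearMap
      (fun t => Matrix.entryLinearMap k A (i t) (i (t + 1)))

lemma gtr_apply (n : ℕ) (M : Fin (n + 1) → Matrix ι ι A) :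
    gtr k A ι n M = ∑ i : Fin (n + 1) → ι,
      PiTensorProduct.tprod k (fun t => M t (i t) (i (t + 1))) := by
  simp [gtr]

lemma tprod_update_sum {n : ℕ} {κ : Type} [Fintype κ] (f : Fin (n + 1) → A) (j : Fin (n + 1))
    (g : κ → A) :
    (∑ l, PiTensorProduct.tprod k (Function.update f j (g l))) =
      PiTensorProduct.tprod k (Function.update f j (∑ l, g l)) := by
  rw [MultilinearMap.map_update_sum]

lemma hmerge_gtr_aux {n : ℕ} (j : Fin (n + 1)) (M : Fin (n + 2) → Matrix ι ι A)
    (l : ι) (i : Fin (n + 1) → ι) :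
    hmerge j (fun t => M t (Fin.insertNth (α := fun _ => ι) j.succ l i t)
      (Fin.insertNth (α := fun _ => ι) j.succ l i (t + 1))) =
    Function.update (fun t => hmerge j M t (i t) (i (t + 1))) j
      (M j.castSucc (i j) l * M j.succ l (i (j + 1))) := by
  have key1 : ∀ t : Fin (n + 1), t ≤ j →
      Fin.insertNth (α := fun _ => ι) j.succ l i t.castSucc = i t := by
    intro t ht
    have : t.castSucc = j.succ.succAbove t := by
      rw [Fin.succAbove_of_castSucc_lt]
      rw [Fin.le_def] at ht
      rw [Fin.lt_def, Fin.val_castSucc, Fin.val_succ]; omega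
    rw [this, Fin.insertNth_apply_succAbove]
  have key2 : ∀ t : Fin (n + 1), j < t →
      Fin.insertNth (α := fun _ => ι) j.succ l i t.succ = i t := by
    intro t ht
    have : t.succ = j.succ.succAbove t := by
      rw [Fin.succAbove_of_le_castSucc]
      rw [Fin.le_def]
      rw [Fin.lt_def] at ht
      simp; omega
    rw [this, Fin.insertNth_apply_succAbove]
  have key3 : ∀ t : Fin (n + 1), j ≤ t →
      Fin.insertNth (α := fun _ => ι) j.succ l i (t.succ + 1) = i (t + 1) := by
    intro t ht
    rcases Fin.eq_castSucc_or_eq_last t with ⟨s, rfl⟩ | rfl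
    · rcases n with _ | n
      · exact s.elim0
      · have h1 : (s.castSucc.succ + 1 : Fin (n + 3)) = s.succ.succ := by
          ext; rw [Fin.val_add_one_of_lt]; simp; simp [Fin.lt_def]; omega
        have h2 : (s.castSucc + 1 : Fin (n + 2)) = s.succ := by
          ext; rw [Fin.val_add_one_of_lt]; simp; simp [Fin.lt_def]; omega
        rw [h1, h2]
        apply key2
        rw [Fin.lt_def]; rw [Fin.le_def] at ht; simp at ht ⊢; omega
    · have h1 : ((Fin.last n).succ + 1 : Fin (n + 2)) = (0 : Fin (n + 1)).castSucc := by
        simp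
      have h2 : (Fin.last n + 1 : Fin (n + 1)) = 0 := by simp
      rw [h1, h2, key1 _ (Fin.zero_le _)]
  have key4 : ∀ t : Fin (n + 1), (t.castSucc + 1 : Fin (n + 2)) = t.succ := by
    intro t; simp
  have key5 : ∀ t : Fin (n + 1), t < j →
      Fin.insertNth (α := fun _ => ι) j.succ l i t.succ = i (t + 1) := by
    intro t ht
    have hl : t < Fin.last n := lt_of_lt_of_le ht (Fin.le_last _)
    have h1 : t.succ = (t + 1).castSucc := by
      ext; rw [Fin.val_castSucc, Fin.val_add_one_of_lt hl]; simp
    rw [h1, key1]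
    rw [Fin.le_def, Fin.val_add_one_of_lt hl]
    exact ht
  funext t
  rcases lt_trichotomy t j with h | h | h
  · rw [Function.update_of_ne h.ne]
    have h' : (t : ℕ) < j := h
    simp only [hmerge, h', if_true]
    rw [key4, key1 t h.le, key5 t h]
  · subst h
    rw [Function.update_self]
    simp only [hmerge, lt_irrefl, if_false, if_true]
    rw [key4, key1 t le_rfl, key3 t le_rfl, Fin.insertNth_apply_same]
  · rw [Function.update_of_ne h.ne']
    have h' : ¬ (t : ℕ) < j := by rw [Fin.lt_def] at h; omega
    have h'' : ¬ (t : ℕ) = j := by rw [Fin.lt_def] at h; omega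
    simp only [hmerge, h', h'', if_false]
    rw [key2 t h, key3 t h.le]

lemma gtr_hmerge {n : ℕ} (j : Fin (n + 1)) (M : Fin (n + 2) → Matrix ι ι A) :
    ∑ i : Fin (n + 2) → ι,
      PiTensorProduct.tprod k (hmerge j (fun t => M t (i t) (i (t + 1)))) =
    gtr k A ι n (hmerge j M) := by
  rw [gtr_apply, ← (Fin.insertNthEquiv (fun _ => ι) j.succ).sum_comp, Fintype.sum_prod_type_right]
  refine Finset.sum_congr rfl fun i _ => ?_
  simp only [Fin.insertNthEquiv_apply]
  simp only [hmerge_gtr_aux]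
  rw [tprod_update_sum]
  congr 1
  rw [Function.update_eq_self_iff]
  simp [hmerge, Matrix.mul_apply]

lemma hrot_gtr_aux {n : ℕ} (M : Fin (n + 2) → Matrix ι ι A)
    (l : ι) (i : Fin (n + 1) → ι) :
    hrot (fun t => M t (Fin.cons (α := fun _ => ι) l (fun t => i (t + 1)) t)
      (Fin.cons (α := fun _ => ι) l (fun t => i (t + 1)) (t + 1))) =
    Function.update (fun t => hrot M t (i t) (i (t + 1))) 0
      (M (Fin.last (n + 1)) (i 0) l * M 0 l (i 1)) := by
  have key4 : ∀ t : Fin (n + 1), (t.castSucc + 1 : Fin (n + 2)) = t.succ := by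
    intro t; simp
  funext t
  rcases Fin.eq_zero_or_eq_succ t with rfl | ⟨s, rfl⟩
  · rw [Function.update_self]
    simp only [hrot, Fin.val_zero, if_true]
    have h1 : (Fin.last (n + 1) + 1 : Fin (n + 2)) = 0 := by simp
    have h2 : (0 + 1 : Fin (n + 2)) = (0 : Fin (n + 1)).succ := by simp
    rw [h1, h2, Fin.cons_zero, Fin.cons_succ, ← Fin.succ_last, Fin.cons_succ]
    simp
  · rw [Function.update_of_ne (Fin.succ_ne_zero s)]
    have h : ¬ ((s.succ : Fin (n + 1)) : ℕ) = 0 := by simp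
    simp only [hrot, h, if_false]
    rw [key4, Fin.cons_succ, ← Fin.succ_castSucc, Fin.cons_succ]
    simp

lemma gtr_hrot {n : ℕ} (M : Fin (n + 2) → Matrix ι ι A) :
    ∑ i : Fin (n + 2) → ι,
      PiTensorProduct.tprod k (hrot (fun t => M t (i t) (i (t + 1)))) =
    gtr k A ι n (hrot M) := by
  rw [gtr_apply, ← (Fin.consEquiv (fun _ => ι)).sum_comp, Fintype.sum_prod_type_right]
  rw [← (Equiv.arrowCongr (Equiv.addRight (1 : Fin (n + 1))).symm (Equiv.refl ι)).sum_comp]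
  refine Finset.sum_congr rfl fun i _ => ?_
  have : ((Equiv.arrowCongr (Equiv.addRight (1 : Fin (n + 1))).symm (Equiv.refl ι)) i)
    = fun t => i (t + 1) := by
    funext t; simp [Equiv.arrowCongr]
  rw [this]
  simp only [Fin.consEquiv_apply]
  simp only [hrot_gtr_aux]
  rw [tprod_update_sum]
  congr 1
  rw [Function.update_eq_self_iff]
  simp [hrot, Matrix.mul_apply]

/-- Hochschild boundary hypothesis -/
def IsHb (b : ∀ n : ℕ, (⨂[k] _ : Fin (n + 2), A) →ₗ[k] (⨂[k] _ : Fin (n + 1), A)) : Prop :=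
  ∀ (n : ℕ) (a : Fin (n + 2) → A),
        b n (PiTensorProduct.tprod k a) =
          (∑ i : Fin (n + 1),
            ((-1 : k) ^ (i : ℕ)) • PiTensorProduct.tprod k (hmerge i a)) +
          ((-1 : k) ^ (n + 1)) • PiTensorProduct.tprod k (hrot a)

variable {b : ∀ n : ℕ, (⨂[k] _ : Fin (n + 2), A) →ₗ[k] (⨂[k] _ : Fin (n + 1), A)}

lemma b_gtr (hb : IsHb b) (n : ℕ) (M : Fin (n + 2) → Matrix ι ι A) :
    b n (gtr k A ι (n + 1) M) =
      (∑ i : Fin (n + 1), ((-1 : k) ^ (i : ℕ)) • gtr k A ι n (hmerge i M)) +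
          ((-1 : k) ^ (n + 1)) • gtr k A ι n (hrot M) := by
  rw [gtr_apply, map_sum]
  simp only [hb n]
  rw [Finset.sum_add_distrib, Finset.sum_comm]
  simp only [← Finset.smul_sum, gtr_hmerge, gtr_hrot]

end trace
section null

set_option linter.unusedSectionVars false

variable {k : Type u} {A : Type u} [Field k] [Ring A] [Algebra k A]
variable {ι : Type} [Fintype ι] [DecidableEq ι]

/-- induced map on chains -/
def Tmap (ρ : A →ₗ[k] Matrix ι ι A) (n : ℕ) :
    (⨂[k] _ : Fin (n + 1), A) →ₗ[k] (⨂[k] _ : Fin (n + 1), A) :=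
  PiTensorProduct.lift ((gtr k A ι n).compLinearMap (fun _ => ρ))

lemma Tmap_tprod (ρ : A →ₗ[k] Matrix ι ι A) (n : ℕ) (a : Fin (n + 1) → A) :
    Tmap ρ n (PiTensorProduct.tprod k a) = gtr k A ι n (fun t => ρ (a t)) := by
  simp [Tmap]

/-- first slot twisted -/
def Gm (ρ : A →ₗ[k] Matrix ι ι A) (S : Matrix ι ι A) {n : ℕ} (a : Fin (n + 1) → A) :
    Fin (n + 1) → Matrix ι ι A := fun t => if t = 0 then S * ρ (a t) else ρ (a t)

/-- homotopy -/
def Hmap {κ : Type} [Fintype κ] (ρ : A →ₗ[k] Matrix ι ι A) (c : κ → A) (S : κ → Matrix ι ι A)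
    (n : ℕ) :
    (⨂[k] _ : Fin (n + 1), A) →ₗ[k] (⨂[k] _ : Fin (n + 2), A) :=
  PiTensorProduct.lift (∑ j,
    (LinearMap.applyₗ (ρ (c j)) :
        (Matrix ι ι A →ₗ[k] (⨂[k] _ : Fin (n + 2), A)) →ₗ[k] _).compMultilinearMap
      ((gtr k A ι (n + 1)).curryRight.compLinearMap
        (fun t => if t = 0 then (LinearMap.mulLeft k (S j)).comp ρ else ρ)))

lemma Hmap_tprod {κ : Type} [Fintype κ] (ρ : A →ₗ[k] Matrix ι ι A) (c : κ → A)
    (S : κ → Matrix ι ι A) (n : ℕ) (a : Fin (n + 1) → A) :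
    Hmap ρ c S n (PiTensorProduct.tprod k a) =
      ∑ j, gtr k A ι (n + 1)
        (Fin.snoc (α := fun _ => Matrix ι ι A) (Gm ρ (S j) a) (ρ (c j))) := by
  rw [Hmap, PiTensorProduct.lift.tprod, sum_apply]
  refine Finset.sum_congr rfl fun j _ => ?_
  simp only [LinearMap.compMultilinearMap_apply, MultilinearMap.compLinearMap_apply,
    LinearMap.applyₗ_apply_apply, MultilinearMap.curryRight_apply]
  congr 2
  funext t
  simp only [Gm]
  split_ifs <;> simp

lemma hmerge_snoc (ρ : A →ₗ[k] Matrix ι ι A) (hρ : ∀ a b, ρ (a * b) = ρ a * ρ b)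
    (S Y : Matrix ι ι A) {n : ℕ} (a : Fin (n + 2) → A) (i : Fin (n + 1)) :
    hmerge i.castSucc (Fin.snoc (α := fun _ => Matrix ι ι A) (Gm ρ S a) Y) =
      Fin.snoc (α := fun _ => Matrix ι ι A) (Gm ρ S (hmerge i a)) Y := by
  funext t
  rcases Fin.eq_castSucc_or_eq_last t with ⟨s, rfl⟩ | rfl
  · simp only [hmerge, Fin.snoc_castSucc, ← Fin.castSucc_succ, Fin.val_castSucc, Gm]
    rcases Fin.eq_zero_or_eq_succ s with rfl | ⟨r, rfl⟩
    · split_ifs <;> simp_all [mul_assoc]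
    · split_ifs <;> simp_all [mul_assoc]
  · have h1 : ¬ (n + 1 < (i : ℕ)) := by omega
    have h2 : ¬ (n + 1 = (i : ℕ)) := by omega
    simp [hmerge, h1, h2]

lemma hmerge_last_snoc (ρ : A →ₗ[k] Matrix ι ι A) (hρ : ∀ a b, ρ (a * b) = ρ a * ρ b)
    (S : Matrix ι ι A) (c : A) {n : ℕ} (a : Fin (n + 2) → A) (W : Fin (n + 2) → Matrix ι ι A)
    (hW : W = fun t => ρ (a t)) :
    hmerge (Fin.last (n + 1)) (Fin.snoc (α := fun _ => Matrix ι ι A) (Gm ρ S a) (ρ c)) =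
      Function.update (Function.update W (Fin.last (n + 1)) (ρ (a (Fin.last (n + 1)) * c))) 0
        (S * ρ (a 0)) := by
  funext t
  rcases Fin.eq_castSucc_or_eq_last t with ⟨s, rfl⟩ | rfl
  · have : ((s : Fin (n + 1)) : ℕ) < n + 1 := s.2
    simp only [hmerge, Fin.val_castSucc, Fin.val_last, this, if_true, Fin.snoc_castSucc, Gm]
    by_cases h : s.castSucc = 0
    · simp [h]
    · rw [Function.update_of_ne h, Function.update_of_ne (Fin.castSucc_lt_last s).ne]
      simp [h, hW]
  · rw [Function.update_of_ne (Fin.last_pos.ne'), Function.update_self]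
    simp [hmerge, Gm, hρ]

lemma snoc_hrot (ρ : A →ₗ[k] Matrix ι ι A) (hρ : ∀ a b, ρ (a * b) = ρ a * ρ b)
    (S : Matrix ι ι A) (c : A) {n : ℕ} (a : Fin (n + 2) → A) (W : Fin (n + 2) → Matrix ι ι A)
    (hW : W = fun t => ρ (a t)) :
    Fin.snoc (α := fun _ => Matrix ι ι A) (Gm ρ S (hrot a)) (ρ c) =
      Function.update (Function.update W (Fin.last (n + 1)) (ρ c)) 0
        ((S * ρ (a (Fin.last (n + 1)))) * ρ (a 0)) := by
  funext t
  rcases Fin.eq_castSucc_or_eq_last t with ⟨s, rfl⟩ | rfl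
  · simp only [Fin.snoc_castSucc, Gm]
    by_cases h : s = 0
    · subst h; simp [hrot, hρ, mul_assoc]
    · have h' : s.castSucc ≠ 0 := by simpa using h
      rw [Function.update_of_ne h', Function.update_of_ne (Fin.castSucc_lt_last s).ne]
      simp [h, hW, hrot]
  · rw [Function.update_of_ne (Fin.last_pos.ne'), Function.update_self]
    simp

lemma hrot_snoc (ρ : A →ₗ[k] Matrix ι ι A)
    (S Y : Matrix ι ι A) {n : ℕ} (a : Fin (n + 2) → A) :
    hrot (Fin.snoc (α := fun _ => Matrix ι ι A) (Gm ρ S a) Y) =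
      Function.update (fun t => ρ (a t)) 0 (Y * S * ρ (a 0)) := by
  funext t
  by_cases h : t = 0
  · subst h
    have : (0 : Fin (n + 3)) = (0 : Fin (n + 2)).castSucc := rfl
    simp only [hrot, Fin.val_zero, if_true, Function.update_self, Fin.snoc_last]
    rw [this, Fin.snoc_castSucc]
    simp [Gm, mul_assoc]
  · rw [Function.update_of_ne h]
    have h' : ¬ ((t : ℕ) = 0) := fun e => h (Fin.ext e)
    simp [hrot, h', Gm, h]

variable {b : ∀ n : ℕ, (⨂[k] _ : Fin (n + 2), A) →ₗ[k] (⨂[k] _ : Fin (n + 1), A)}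

lemma homotopy_id (hb : IsHb b) {κ : Type} [Fintype κ] (ρ : A →ₗ[k] Matrix ι ι A)
    (hρ : ∀ a b, ρ (a * b) = ρ a * ρ b) (c : κ → A) (S : κ → Matrix ι ι A)
    (lam : A → κ → κ → k)
    (h1 : ∀ a j, a * c j = ∑ l, lam a j l • c l)
    (h2 : ∀ a l, S l * ρ a = ∑ j, lam a j l • S j)
    (h3 : ∀ a, ∑ j, ρ (c j) * S j * ρ a = ρ a) (n : ℕ) (a : Fin (n + 2) → A) :
    b (n + 1) (Hmap ρ c S (n + 1) (PiTensorProduct.tprod k a)) =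
      Hmap ρ c S n (b n (PiTensorProduct.tprod k a)) +
        ((-1 : k) ^ (n + 2)) • Tmap ρ (n + 1) (PiTensorProduct.tprod k a) := by
  rw [Hmap_tprod, map_sum, Tmap_tprod, hb n, map_add, map_sum]
  simp only [map_smul, Hmap_tprod, b_gtr hb, Fin.sum_univ_castSucc (n := n + 1)]
  simp only [hmerge_snoc ρ hρ, hrot_snoc, Finset.sum_add_distrib]
  rw [Finset.sum_comm]
  simp only [← Finset.smul_sum, Fin.val_castSucc, Fin.val_last]
  congr 1
  · congr 2
    simp only [hmerge_last_snoc ρ hρ _ _ a _ rfl, snoc_hrot ρ hρ _ _ a _ rfl]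
    simp only [h1, h2, map_sum, map_smul, Finset.sum_mul, smul_mul_assoc]
    have e0 : ∀ (X Y : Matrix ι ι A), Function.update (Function.update (fun t => ρ (a t))
        (Fin.last (n + 1)) Y) 0 X = Function.update (Function.update (fun t => ρ (a t))
        0 X) (Fin.last (n + 1)) Y := fun X Y => Function.update_comm Fin.last_pos.ne' _ _ _
    simp only [e0, MultilinearMap.map_update_sum, MultilinearMap.map_update_smul]
    simp only [← e0, MultilinearMap.map_update_sum, MultilinearMap.map_update_smul]
    rw [Finset.sum_comm]
  · rw [← MultilinearMap.map_update_sum, h3]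
    simp

lemma null_of_data (hb : IsHb b) {κ : Type} [Fintype κ] (ρ : A →ₗ[k] Matrix ι ι A)
    (hρ : ∀ a b, ρ (a * b) = ρ a * ρ b) (c : κ → A) (S : κ → Matrix ι ι A)
    (lam : A → κ → κ → k)
    (h1 : ∀ a j, a * c j = ∑ l, lam a j l • c l)
    (h2 : ∀ a l, S l * ρ a = ∑ j, lam a j l • S j)
    (h3 : ∀ a, ∑ j, ρ (c j) * S j * ρ a = ρ a) (n : ℕ) (z : ⨂[k] _ : Fin (n + 2), A)
    (hz : b n z = 0) : Tmap ρ (n + 1) z ∈ LinearMap.range (b (n + 1)) := by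
  have key : (b (n + 1)).comp (Hmap ρ c S (n + 1)) = (Hmap ρ c S n).comp (b n) +
      ((-1 : k) ^ (n + 2)) • Tmap ρ (n + 1) := by
    apply PiTensorProduct.ext
    ext a
    simpa using homotopy_id hb ρ hρ c S lam h1 h2 h3 n a
  have := LinearMap.congr_fun key z
  simp only [LinearMap.comp_apply, LinearMap.add_apply, hz, map_zero, zero_add,
    LinearMap.smul_apply] at this
  refine ⟨((-1 : k) ^ (n + 2)) • Hmap ρ c S (n + 1) z, ?_⟩
  rw [map_smul, this, smul_smul, ← mul_pow]
  simp

lemma gtr_sum {ι₁ ι₂ : Type} [Fintype ι₁] [DecidableEq ι₁] [Fintype ι₂] [DecidableEq ι₂]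
    (n : ℕ) (M : Fin (n + 1) → Matrix (ι₁ ⊕ ι₂) (ι₁ ⊕ ι₂) A)
    (hM : ∀ t i j, M t (Sum.inr i) (Sum.inl j) = 0) :
    gtr k A (ι₁ ⊕ ι₂) n M = gtr k A ι₁ n (fun t => (M t).toBlocks₁₁) +
      gtr k A ι₂ n (fun t => (M t).toBlocks₂₂) := by
  classical
  simp only [gtr_apply]
  let f : (Fin (n + 1) → ι₁) ⊕ (Fin (n + 1) → ι₂) → (Fin (n + 1) → ι₁ ⊕ ι₂) :=
    Sum.elim (fun i t => Sum.inl (i t)) (fun i t => Sum.inr (i t))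
  have hf : Function.Injective f := by
    rintro (x | x) (y | y) h
    · congr 1; funext t; simpa [f] using congrFun h t
    · simpa [f] using congrFun h 0
    · simpa [f] using congrFun h 0
    · congr 1; funext t; simpa [f] using congrFun h t
  have hz : ∀ i : Fin (n + 1) → ι₁ ⊕ ι₂, i ∉ Set.range f →
      PiTensorProduct.tprod k (fun t => M t (i t) (i (t + 1))) = 0 := by
    intro i hi
    by_contra hne
    have hstep : ∀ t, (i t).isRight → (i (t + 1)).isRight := by
      intro t ht
      by_contra hl
      apply hne
      apply MultilinearMap.map_coord_zero _ t
      obtain ⟨x, hx⟩ := Sum.isRight_iff.1 ht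
      obtain ⟨y, hy⟩ := Sum.isLeft_iff.1 (by simpa using hl)
      rw [hx, hy, hM]
    apply hi
    by_cases hex : ∃ t, (i t).isRight
    · obtain ⟨t, ht⟩ := hex
      have h2 : ∀ (m : ℕ) (h : (t : ℕ) + m < n + 1), (i ⟨t + m, h⟩).isRight := by
        intro m
        induction m with
        | zero => intro h; simpa using ht
        | succ m ih =>
          intro h
          have := hstep _ (ih (by omega))
          convert this using 3
          ext
          rw [Fin.val_add_one_of_lt]
          · simp; omega
          · rw [Fin.lt_def]; simp; omega
      have hl : (i (Fin.last n)).isRight := by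
        have := h2 (n - t) (by omega)
        convert this using 3
        ext; simp; omega
      have h0 : (i 0).isRight := by
        have := hstep _ hl
        simpa using this
      have h3 : ∀ s, (i s).isRight := by
        intro s
        induction s using Fin.induction with
        | zero => exact h0
        | succ s ih =>
          have := hstep _ ih
          simpa using this
      choose g hg using fun s => Sum.isRight_iff.1 (h3 s)
      exact ⟨Sum.inr g, by funext s; simp [f, hg]⟩
    · push Not at hex
      choose g hg using fun s => Sum.isLeft_iff.1 (by simpa using hex s)
      exact ⟨Sum.inl g, by funext s; simp [f, hg]⟩
  rw [← Finset.sum_subset (Finset.subset_univ (Finset.univ.image f)), Finset.sum_image hf.injOn,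
    Fintype.sum_sum_type]
  · rfl
  · intro i _ hi
    exact hz i (by simpa using hi)

lemma Tmap_sum {ι₁ ι₂ : Type} [Fintype ι₁] [DecidableEq ι₁] [Fintype ι₂] [DecidableEq ι₂]
    (ρ : A →ₗ[k] Matrix (ι₁ ⊕ ι₂) (ι₁ ⊕ ι₂) A) (ρ₁ : A →ₗ[k] Matrix ι₁ ι₁ A)
    (ρ₂ : A →ₗ[k] Matrix ι₂ ι₂ A)
    (h21 : ∀ a i j, ρ a (Sum.inr i) (Sum.inl j) = 0)
    (h11 : ∀ a i j, ρ a (Sum.inl i) (Sum.inl j) = ρ₁ a i j)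
    (h22 : ∀ a i j, ρ a (Sum.inr i) (Sum.inr j) = ρ₂ a i j) (n : ℕ) :
    Tmap ρ n = Tmap ρ₁ n + Tmap ρ₂ n := by
  apply PiTensorProduct.ext
  ext a
  simp only [LinearMap.compMultilinearMap_apply, LinearMap.add_apply, Tmap_tprod]
  rw [gtr_sum _ _ (fun t => h21 (a t))]
  congr 2
  · funext t; ext i j; exact h11 _ _ _
  · funext t; ext i j; exact h22 _ _ _

lemma Tmap_unit (ρ : A →ₗ[k] Matrix Unit Unit A) (h : ∀ a i j, ρ a i j = a) (n : ℕ) :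
    Tmap ρ n = LinearMap.id := by
  apply PiTensorProduct.ext
  ext a
  simp only [LinearMap.compMultilinearMap_apply, Tmap_tprod, gtr_apply, h]
  simp

end null
section frames

set_option linter.unusedSectionVars false

variable {k : Type u} {A : Type u} [Field k] [Ring A] [Algebra k A]

/-- left multiplication element -/
def lE (k : Type u) {A : Type u} [Field k] [Ring A] [Algebra k A] (a : A) : A ⊗[k] Aᵐᵒᵖ :=
  a ⊗ₜ 1

/-- right multiplication element -/
def rE (k : Type u) {A : Type u} [Field k] [Ring A] [Algebra k A] (a : A) : A ⊗[k] Aᵐᵒᵖ :=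
  1 ⊗ₜ (MulOpposite.op a)

lemma lE_mul (a b : A) : lE k (a * b) = lE k a * lE k b := by simp [lE]
lemma rE_mul (a b : A) : rE k (a * b) = rE k b * rE k a := by simp [rE]
lemma lE_add (a b : A) : lE k (a + b) = lE k a + lE k b := by simp [lE, TensorProduct.add_tmul]
lemma rE_add (a b : A) : rE k (a + b) = rE k a + rE k b := by simp [rE, TensorProduct.tmul_add]
lemma rE_sum {κ : Type} (s : Finset κ) (f : κ → A) :
    rE k (∑ j ∈ s, f j) = ∑ j ∈ s, rE k (f j) := by
  classical
  induction s using Finset.induction_on with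
  | empty => simp [rE]
  | insert j s hj ih => rw [Finset.sum_insert hj, Finset.sum_insert hj, rE_add, ih]
lemma lE_smul (c : k) (a : A) : lE k (c • a) = rE k (c • (1 : A)) * lE k a := by
  rw [lE, lE, rE, MulOpposite.op_smul, Algebra.TensorProduct.tmul_mul_tmul, one_mul, mul_one,
    MulOpposite.op_one, TensorProduct.smul_tmul]
lemma lE_rE (a b : A) : lE k a * rE k b = rE k b * lE k a := by simp [lE, rE]
lemma lE_one : lE k (1 : A) = 1 := rfl
lemma rE_one : rE k (1 : A) = 1 := rfl

/-- right dual basis of a bimodule -/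
structure Fr (k A : Type u) [Field k] [Ring A] [Algebra k A] (ι : Type) [Fintype ι]
    (M : Type u) [AddCommGroup M] [Module (A ⊗[k] Aᵐᵒᵖ) M] where
  x : ι → M
  φ : ι → M →+ A
  hφ : ∀ i a m, φ i (rE k a • m) = φ i m * a
  hx : ∀ m, ∑ i, rE k (φ i m) • x i = m

variable {ι : Type} [Fintype ι] [DecidableEq ι] {M : Type u} [AddCommGroup M]
  [Module (A ⊗[k] Aᵐᵒᵖ) M]

/-- matrix of a right-linear endomorphism -/
def Fr.mat (F : Fr k A ι M) (f : M →+ M) : Matrix ι ι A := fun i j => F.φ i (f (F.x j))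

lemma Fr.mat_mul (F : Fr k A ι M) (f g : M →+ M) (hf : ∀ (a : A) m, f (rE k a • m) = rE k a • f m) :
    F.mat (f.comp g) = F.mat f * F.mat g := by
  ext i j
  simp only [Fr.mat, Matrix.mul_apply, AddMonoidHom.comp_apply]
  conv_lhs => rw [← F.hx (g (F.x j))]
  simp only [map_sum, hf, F.hφ]

/-- left action -/
def lact (k : Type u) {A : Type u} [Field k] [Ring A] [Algebra k A] (M : Type u) [AddCommGroup M]
  [Module (A ⊗[k] Aᵐᵒᵖ) M] (a : A) : M →+ M := DistribSMul.toAddMonoidHom M (lE k a)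

lemma lact_apply (a : A) (m : M) : lact k M a m = lE k a • m := rfl

lemma lact_right (a b : A) (m : M) : lact k M a (rE k b • m) = rE k b • lact k M a m := by
  simp only [lact_apply, smul_smul, lE_rE]

/-- representation -/
def Fr.rho (F : Fr k A ι M) : A →ₗ[k] Matrix ι ι A where
  toFun a := F.mat (lact k M a)
  map_add' a b := by ext i j; simp [Fr.mat, lact_apply, lE_add, add_smul]
  map_smul' c a := by
    ext i j
    simp [Fr.mat, lact_apply, lE_smul, mul_smul, F.hφ]

lemma Fr.rho_apply (F : Fr k A ι M) (a : A) (i j : ι) :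
    F.rho a i j = F.φ i (lE k a • F.x j) := rfl

lemma Fr.rho_mul (F : Fr k A ι M) (a b : A) : F.rho (a * b) = F.rho a * F.rho b := by
  change F.mat (lact k M (a * b)) = F.mat (lact k M a) * F.mat (lact k M b)
  rw [← F.mat_mul _ _ (lact_right a)]
  congr 1
  ext m
  simp [lact_apply, lE_mul, mul_smul]

/-- coordinates on the first factor -/
def psi (f : A →ₗ[k] k) : A ⊗[k] Aᵐᵒᵖ →ₗ[k] A ⊗[k] Aᵐᵒᵖ :=
  LinearMap.rTensor Aᵐᵒᵖ ((Algebra.linearMap k A).comp f)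

lemma psi_tmul (f : A →ₗ[k] k) (a : A) (b : Aᵐᵒᵖ) :
    psi f (a ⊗ₜ b) = f a • (1 ⊗ₜ b) := by
  simp [psi, Algebra.algebraMap_eq_smul_one, TensorProduct.smul_tmul']

lemma psi_rE (f : A →ₗ[k] k) (a : A) (u : A ⊗[k] Aᵐᵒᵖ) :
    psi f (rE k a * u) = rE k a * psi f u := by
  induction u with
  | zero => simp
  | add x y hx hy => simp [mul_add, hx, hy]
  | tmul x y => simp [rE, psi_tmul, mul_smul_comm]

lemma psi_sum {κ : Type} [Fintype κ] (c : Module.Basis κ k A) (u : A ⊗[k] Aᵐᵒᵖ) :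
    ∑ j, lE k (c j) * psi (c.coord j) u = u := by
  induction u with
  | zero => simp
  | add x y hx hy => simp [mul_add, hx, hy, Finset.sum_add_distrib]
  | tmul x y =>
    simp only [psi_tmul, lE, mul_smul_comm, Algebra.TensorProduct.tmul_mul_tmul, mul_one, one_mul,
      TensorProduct.smul_tmul', ← TensorProduct.sum_tmul]
    congr 1
    simpa using c.sum_repr x

lemma psi_lE {κ : Type} [Fintype κ] (c : Module.Basis κ k A) (a : A) (l : κ)
    (u : A ⊗[k] Aᵐᵒᵖ) :
    psi (c.coord l) (lE k a * u) = ∑ j, c.coord l (a * c j) • psi (c.coord j) u := by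
  induction u with
  | zero => simp
  | add x y hx hy => simp [mul_add, hx, hy, Finset.sum_add_distrib]
  | tmul x y =>
    simp only [psi_tmul, lE, Algebra.TensorProduct.tmul_mul_tmul, one_mul, smul_smul,
      ← Finset.sum_smul]
    congr 1
    conv_lhs => rw [← c.sum_repr x]
    simp only [Finset.mul_sum, mul_smul_comm, map_sum, map_smul, smul_eq_mul, Module.Basis.coord_apply]
    exact Finset.sum_congr rfl fun _ _ => mul_comm _ _

variable [FiniteDimensional k A]

variable {b : ∀ n : ℕ, (⨂[k] _ : Fin (n + 2), A) →ₗ[k] (⨂[k] _ : Fin (n + 1), A)}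

lemma null_of_projective (hb : IsHb b) [Module.Projective (A ⊗[k] Aᵐᵒᵖ) M] (F : Fr k A ι M)
    (n : ℕ) (z : ⨂[k] _ : Fin (n + 2), A)
    (hz : b n z = 0) : Tmap F.rho (n + 1) z ∈ LinearMap.range (b (n + 1)) := by
  obtain ⟨t, ht⟩ := Module.projective_def'.1 (‹Module.Projective (A ⊗[k] Aᵐᵒᵖ) M›)
  let c := Module.finBasis k A
  have hz0 : ∀ m : M, (0 : A ⊗[k] Aᵐᵒᵖ) • m = 0 := fun m => zero_smul (A ⊗[k] Aᵐᵒᵖ) m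
  let s : Fin (Module.finrank k A) → M →+ M := fun j =>
    ((Finsupp.linearCombination (A ⊗[k] Aᵐᵒᵖ) (id : M → M)).toAddMonoidHom.comp
      (Finsupp.mapRange.addMonoidHom (psi (c.coord j)).toAddMonoidHom)).comp t.toAddMonoidHom
  have hs : ∀ j m, s j m = (t m).sum fun y u => psi (c.coord j) u • y := by
    intro j m
    simp only [s, AddMonoidHom.comp_apply, Finsupp.mapRange.addMonoidHom_apply]
    change Finsupp.linearCombination (A ⊗[k] Aᵐᵒᵖ) (id : M → M) (Finsupp.mapRange _ _ (t m)) = _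
    rw [Finsupp.linearCombination_apply, Finsupp.sum_mapRange_index (h := fun i (a : A ⊗[k] Aᵐᵒᵖ) => a • id i) (fun a => hz0 a)]
    rfl
  have hsr : ∀ j (a : A) m, s j (rE k a • m) = rE k a • s j m := by
    intro j a m
    rw [hs, hs, map_smul, Finsupp.sum_smul_index' (by intro i; rw [map_zero]; exact hz0 i), Finsupp.smul_sum]
    simp only [smul_eq_mul, psi_rE, mul_smul]
  have hsl : ∀ l (a : A) m, s l (lE k a • m) = ∑ j, rE k (c.coord l (a * c j) • (1 : A)) • s j m := by
    intro l a m
    simp only [hs]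
    rw [map_smul, Finsupp.sum_smul_index' (by intro i; rw [map_zero]; exact hz0 i)]
    simp only [smul_eq_mul, psi_lE, Finset.sum_smul]
    simp only [Finsupp.sum]
    rw [Finset.sum_comm]
    refine Finset.sum_congr rfl fun j _ => ?_
    rw [Finset.smul_sum]
    refine Finset.sum_congr rfl fun y _ => ?_
    rw [smul_smul]
    congr 1
    simp [rE, TensorProduct.tmul_smul, ← Algebra.TensorProduct.one_def]
  have hss : ∀ m, ∑ j, lE k (c j) • s j m = m := by
    intro m
    simp only [hs, Finsupp.smul_sum, smul_smul]
    simp only [Finsupp.sum]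
    rw [Finset.sum_comm]
    simp only [← Finset.sum_smul, psi_sum]
    have := LinearMap.congr_fun ht m
    simpa [Finsupp.linearCombination_apply, Finsupp.sum] using this
  refine null_of_data hb F.rho F.rho_mul (fun j => c j) (fun j => F.mat (s j))
    (fun a j l => c.coord l (a * c j)) ?_ ?_ ?_ n z hz
  · intro a j
    simpa using (c.sum_repr (a * c j)).symm
  · intro a l
    change F.mat (s l) * F.mat (lact k M a) = _
    rw [← F.mat_mul _ _ (hsr l)]
    ext i j
    simp only [Fr.mat, AddMonoidHom.comp_apply, lact_apply, hsl, map_sum, F.hφ, Matrix.sum_apply,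
      Matrix.smul_apply]
    simp
  · intro a
    have : ∀ j, F.rho (c j) * F.mat (s j) = F.mat ((lact k M (c j)).comp (s j)) := fun j =>
      (F.mat_mul _ _ (lact_right (c j))).symm
    simp only [this]
    rw [← Finset.sum_mul]
    have h1 : ∑ j, F.mat ((lact k M (c j)).comp (s j)) = F.mat (AddMonoidHom.id M) := by
      ext i l
      simp only [Fr.mat, Matrix.sum_apply, AddMonoidHom.comp_apply, lact_apply, ← map_sum, hss]
      simp
    rw [h1]
    change _ * F.mat (lact k M a) = F.mat (lact k M a)
    rw [← F.mat_mul _ _ (fun _ _ => rfl)]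
    rfl

end frames
lemma pd_ker {R : Type u} [Ring R] {P M : Type u} [AddCommGroup P] [AddCommGroup M] [Module R P]
    [Module R M] [Module.Projective R P] (p : P →ₗ[R] M) (hp : Function.Surjective p) (m : ℕ)
    (h : HasProjectiveDimensionLT (ModuleCat.of R M) (m + 2)) :
    HasProjectiveDimensionLT (ModuleCat.of R (LinearMap.ker p)) (m + 1) := by
  have hP' := (IsProjective.iff_projective (R := R) P).1 inferInstance
  let Sc := ShortComplex.moduleCatMk (LinearMap.ker p).subtype p (by ext; simp)
  have hS : Sc.ShortExact :=
    { exact := by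
        rw [ShortComplex.moduleCat_exact_iff_range_eq_ker]
        exact Submodule.range_subtype _
      mono_f := (ModuleCat.mono_iff_injective _).2 (Submodule.injective_subtype _)
      epi_g := (ModuleCat.epi_iff_surjective _).2 hp }
  exact (hS.hasProjectiveDimensionLT_X₃_iff m hP').1 h

section induct

set_option linter.unusedSectionVars false

variable {k : Type u} {A : Type u} [Field k] [Ring A] [Algebra k A]
variable {ι : Type} [Fintype ι] [DecidableEq ι] {M : Type u} [AddCommGroup M]
  [Module (A ⊗[k] Aᵐᵒᵖ) M]
variable {κ : Type} [Fintype κ] [DecidableEq κ] {P : Type u} [AddCommGroup P]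
  [Module (A ⊗[k] Aᵐᵒᵖ) P]

lemma frame_step (FP : Fr k A κ P) (F : Fr k A ι M) (p : P →ₗ[A ⊗[k] Aᵐᵒᵖ] M) (σ : M →+ P)
    (hσ : ∀ (a : A) m, σ (rE k a • m) = rE k a • σ m) (hpσ : ∀ m, p (σ m) = m) :
    ∃ (FK : Fr k A κ (LinearMap.ker p)) (F' : Fr k A (κ ⊕ ι) P),
      ∀ n, Tmap F'.rho n = Tmap FK.rho n + Tmap F.rho n := by
  let r : P →+ LinearMap.ker p :=
    { toFun := fun y => ⟨y - σ (p y), by simp [LinearMap.mem_ker, hpσ]⟩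
      map_zero' := by simp
      map_add' := fun x y => by
        ext
        simp only [map_add, Submodule.coe_add]
        abel }
  have hr : ∀ y, (r y : P) = y - σ (p y) := fun y => rfl
  have hrr : ∀ (a : A) y, r (rE k a • y) = rE k a • r y := by
    intro a y
    ext
    simp only [hr, Submodule.coe_smul, map_smul, hσ, smul_sub]
  have hrK : ∀ y : LinearMap.ker p, r (y : P) = y := by
    intro y
    ext
    rw [hr, LinearMap.mem_ker.1 y.2, map_zero, sub_zero]
  let FK : Fr k A κ (LinearMap.ker p) :=
    { x := fun i => r (FP.x i)
      φ := fun i => (FP.φ i).comp (LinearMap.ker p).subtype.toAddMonoidHom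
      hφ := fun i a m => FP.hφ i a m
      hx := fun m => by
        have := congrArg r (FP.hx (m : P))
        rw [map_sum, hrK] at this
        simp only [hrr] at this
        exact this }
  let F' : Fr k A (κ ⊕ ι) P :=
    { x := Sum.elim (fun i => (FK.x i : P)) (fun i => σ (F.x i))
      φ := Sum.elim (fun i => (FK.φ i).comp r) (fun i => (F.φ i).comp p.toAddMonoidHom)
      hφ := by
        rintro (i | i) a m
        · simp only [Sum.elim_inl, AddMonoidHom.comp_apply, hrr, FK.hφ]
        · change F.φ i (p (rE k a • m)) = F.φ i (p m) * a
          rw [map_smul, F.hφ]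
      hx := by
        intro m
        rw [Fintype.sum_sum_type]
        have h1 : ∑ i, rE k (FK.φ i (r m)) • (FK.x i : P) = (r m : P) := by
          have := congrArg (Subtype.val) (FK.hx (r m))
          simpa using this
        have h2 : ∑ i, rE k (F.φ i (p m)) • σ (F.x i) = σ (p m) := by
          conv_rhs => rw [← F.hx (p m)]
          simp only [map_sum, hσ]
        change ∑ i, rE k (FK.φ i (r m)) • (FK.x i : P) + ∑ i, rE k (F.φ i (p m)) • σ (F.x i) = m
        rw [h1, h2, hr]
        abel }
  refine ⟨FK, F', fun n => Tmap_sum _ _ _ ?_ ?_ ?_ n⟩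
  · intro a i j
    change F.φ i (p (lE k a • (FK.x j : P))) = 0
    rw [map_smul, LinearMap.mem_ker.1 (FK.x j).2, smul_zero, map_zero]
  · intro a i j
    change FK.φ i (r ((lE k a • FK.x j : LinearMap.ker p) : P)) = FK.φ i (lE k a • FK.x j)
    rw [hrK]
  · intro a i j
    change F.φ i (p (lE k a • σ (F.x j))) = F.φ i (lE k a • F.x j)
    rw [map_smul, hpσ]

/-- right coordinates -/
def theta (f : A →ₗ[k] k) : A ⊗[k] Aᵐᵒᵖ →ₗ[k] A :=
  (MulOpposite.opLinearEquiv k).symm.toLinearMap.comp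
    ((TensorProduct.lid k Aᵐᵒᵖ).toLinearMap.comp (LinearMap.rTensor Aᵐᵒᵖ f))

lemma theta_tmul (f : A →ₗ[k] k) (a : A) (b : Aᵐᵒᵖ) :
    theta f (a ⊗ₜ b) = f a • b.unop := by
  simp [theta]

lemma rE_theta (f : A →ₗ[k] k) (u : A ⊗[k] Aᵐᵒᵖ) : rE k (theta f u) = psi f u := by
  induction u with
  | zero => simp [rE]
  | add x y hx hy => simp [rE_add, hx, hy]
  | tmul x y => simp [theta_tmul, psi_tmul, rE, TensorProduct.tmul_smul]

lemma theta_rE (f : A →ₗ[k] k) (a : A) (u : A ⊗[k] Aᵐᵒᵖ) :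
    theta f (rE k a * u) = theta f u * a := by
  induction u with
  | zero => simp
  | add x y hx hy => simp [mul_add, add_mul, hx, hy]
  | tmul x y => simp [theta_tmul, rE]

/-- frame of a free bimodule -/
def freeFr {d : ℕ} (c : Module.Basis (Fin d) k A) (ι : Type) [Fintype ι] [DecidableEq ι] :
    Fr k A (ι × Fin d) (ι → A ⊗[k] Aᵐᵒᵖ) where
  x ij := Pi.single ij.1 (lE k (c ij.2))
  φ ij := (theta (c.coord ij.2)).toAddMonoidHom.comp (Pi.evalAddMonoidHom _ ij.1)
  hφ ij a m := theta_rE _ _ _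
  hx m := by
    funext i
    rw [Finset.sum_apply, Fintype.sum_prod_type, Finset.sum_eq_single i]
    · simp only [Pi.smul_apply, Pi.single_eq_same, smul_eq_mul]
      conv_rhs => rw [← psi_sum c (m i)]
      refine Finset.sum_congr rfl fun j _ => ?_
      rw [← rE_theta, lE_rE]
      rfl
    · intro i' _ hne
      refine Finset.sum_eq_zero fun j _ => ?_
      simp [Pi.single_eq_of_ne hne.symm]
    · simp

variable [FiniteDimensional k A]
variable {b : ∀ n : ℕ, (⨂[k] _ : Fin (n + 2), A) →ₗ[k] (⨂[k] _ : Fin (n + 1), A)}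

lemma null_of_pd (hb : IsHb b) (m : ℕ) : ∀ (M : Type u) [AddCommGroup M]
    [Module (A ⊗[k] Aᵐᵒᵖ) M] (ι : Type) [Fintype ι] [DecidableEq ι] (F : Fr k A ι M)
    (_ : HasProjectiveDimensionLT (ModuleCat.of (A ⊗[k] Aᵐᵒᵖ) M) (m + 1))
    (n : ℕ) (z : ⨂[k] _ : Fin (n + 2), A)
    (_ : b n z = 0), Tmap F.rho (n + 1) z ∈ LinearMap.range (b (n + 1)) := by
  induction m with
  | zero =>
    intro M _ _ ι _ _ F h n z hz
    have : Projective (ModuleCat.of (A ⊗[k] Aᵐᵒᵖ) M) := by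
      rw [projective_iff_hasProjectiveDimensionLE_zero]; exact h
    have := (IsProjective.iff_projective (R := A ⊗[k] Aᵐᵒᵖ) M).2 this
    exact null_of_projective hb F n z hz
  | succ m ih =>
    intro M _ _ ι _ _ F h n z hz
    let p : (ι → A ⊗[k] Aᵐᵒᵖ) →ₗ[A ⊗[k] Aᵐᵒᵖ] M :=
      Fintype.linearCombination (A ⊗[k] Aᵐᵒᵖ) F.x
    let σ : M →+ (ι → A ⊗[k] Aᵐᵒᵖ) :=
      { toFun := fun m i => rE k (F.φ i m)
        map_zero' := by funext i; simp [rE]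
        map_add' := fun x y => by funext i; simp [rE_add] }
    have hσ : ∀ (a : A) m, σ (rE k a • m) = rE k a • σ m := by
      intro a m
      funext i
      change rE k (F.φ i (rE k a • m)) = rE k a * rE k (F.φ i m)
      rw [F.hφ, rE_mul]
    have hpσ : ∀ m, p (σ m) = m := by
      intro m
      exact F.hx m
    obtain ⟨FK, F', hT⟩ := frame_step (freeFr (Module.finBasis k A) ι) F p σ hσ hpσ
    have hP : Module.Projective (A ⊗[k] Aᵐᵒᵖ) (ι → A ⊗[k] Aᵐᵒᵖ) := inferInstance
    have hK := pd_ker p (fun m => ⟨σ m, hpσ m⟩) m h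
    have h1 := ih (LinearMap.ker p) _ FK hK n z hz
    have h2 := null_of_projective hb F' n z hz
    rw [hT, LinearMap.add_apply] at h2
    exact (Submodule.add_mem_iff_right _ h1).1 h2

end induct

lemma pd_of_resolution {C : Type*} [Category C] [Abelian C] {X : C}
    (res : ProjectiveResolution X) (m : ℕ)
    (h : ∀ i : ℕ, m < i → Limits.IsZero (res.complex.X i)) :
    HasProjectiveDimensionLT X (m + 1) := by
  let := HasExt.standard C
  rw [hasProjectiveDimensionLT_iff]
  intro i hi Y e
  obtain ⟨f, hf, rfl⟩ := res.extMk_surjective e (i + 1) rfl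
  obtain rfl : f = 0 := (h i (by omega)).eq_of_src _ _
  simp

attribute [local instance] TensorProduct.Algebra.module

/-- the frame of the diagonal bimodule -/
def diagFr (k A : Type u) [Field k] [Ring A] [Algebra k A] : Fr k A Unit A where
  x _ := 1
  φ _ := AddMonoidHom.id A
  hφ i a m := by simp [rE, TensorProduct.Algebra.smul_def]
  hx m := by simp [rE, TensorProduct.Algebra.smul_def]

/-- Let `A` be a finite-dimensional associative algebra over a field `k`
which is smooth: `A` admits a finite resolution by finitely generated projective
`A`-bimodules (= modules over `A ⊗ₖ Aᵐᵒᵖ`).  Let `b n : A^{⊗(n+2)} → A^{⊗(n+1)}` be the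
Hochschild boundary maps.  Then the Hochschild homology of `A` vanishes in nonzero degrees
(`ker (b n) = range (b (n+1))` for all `n`), and `HH₀(A) = A/[A,A]` (the image of `b 0` in
`A` is the span of commutators). -/
theorem stmt13 {k : Type u} {A : Type u} [Field k] [Ring A] [Algebra k A]
    [FiniteDimensional k A]
    (hsmooth : ∃ (m : ℕ)
        (res : ProjectiveResolution (ModuleCat.of (A ⊗[k] Aᵐᵒᵖ) A)),
        (∀ i : ℕ, m < i → Limits.IsZero (res.complex.X i)) ∧
        (∀ i : ℕ, Module.Finite (A ⊗[k] Aᵐᵒᵖ) (res.complex.X i)))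
    (b : ∀ n : ℕ, (⨂[k] _ : Fin (n + 2), A) →ₗ[k] (⨂[k] _ : Fin (n + 1), A))
    (hb : ∀ (n : ℕ) (a : Fin (n + 2) → A),
        b n (PiTensorProduct.tprod k a) =
          (∑ i : Fin (n + 1),
            ((-1 : k) ^ (i : ℕ)) • PiTensorProduct.tprod k (hmerge i a)) +
          ((-1 : k) ^ (n + 1)) • PiTensorProduct.tprod k (hrot a)) :
    (∀ n : ℕ, LinearMap.ker (b n) ≤ LinearMap.range (b (n + 1))) ∧
    LinearMap.range
        ((PiTensorProduct.subsingletonEquiv (0 : Fin 1)).toLinearMap.comp (b 0)) =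
      Submodule.span k {x : A | ∃ y z : A, x = y * z - z * y} := by
  constructor
  · intro n z hz
    obtain ⟨m, res, h0, -⟩ := hsmooth
    have hpd := pd_of_resolution res m h0
    have := null_of_pd (b := b) hb m A Unit (diagFr k A) hpd n z hz
    rwa [Tmap_unit, LinearMap.id_apply] at this
    intro a i j
    rw [Fr.rho_apply]
    simp [diagFr, lE, TensorProduct.Algebra.smul_def]
  · have key : ∀ a : Fin 2 → A, (PiTensorProduct.subsingletonEquiv (0 : Fin 1)).toLinearMap.comp
        (b 0) (PiTensorProduct.tprod k a) = a 0 * a 1 - a 1 * a 0 := by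
      intro a
      simp [hb, hmerge, hrot, sub_eq_add_neg]
    rw [LinearMap.range_eq_map, ← PiTensorProduct.span_tprod_eq_top, Submodule.map_span]
    congr 1
    ext x
    constructor
    · rintro ⟨_, ⟨a, rfl⟩, rfl⟩
      exact ⟨a 0, a 1, key a⟩
    · rintro ⟨y, z, rfl⟩
      exact ⟨_, ⟨![y, z], rfl⟩, key _⟩

end
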